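/- arXiv:2211.09991 — 12 statements merged into one kernel-verified Lean document; each statement's English description precedes it below -/
import Mathlib

section
/- Let (g,[·,·],T) be a Rota-Baxter Leibniz algebra of weight λ over a field k of characteristic 0 and let (V,ρL,ρR,T_V) be a representation of it. Then (V,ρL,ρR, 2T_V + λ·id_V) is a representation of the modified Rota-Baxter Leibniz algebra (g,[·,·], 2T + λ·id_g) of weight −λ²; that is, for all x ∈ g and v ∈ V: ρL((2T+λ id)(x))((2T_V+λ id)(v)) = (2T_V+λ id)(ρL((2T+λ id)(x))v + ρL(x)((2T_V+λ id)(v))) − λ² ρL(x)v, and the same identity with ρL replaced by ρR. -/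
/-- If `TV` satisfies the Rota-Baxter identity of weight `lam` over `T` with respect to a linear
map `ρ : g → End V`, then `2 TV + lam • id` satisfies the modified Rota-Baxter identity of weight
`-lam ^ 2` over `2 T + lam • id`. -/
theorem modified_rotaBaxter_of_rotaBaxter {k g V : Type*} [CommRing k]
    [AddCommGroup g] [Module k g] [AddCommGroup V] [Module k V]
    (lam : k) (T : g →ₗ[k] g) (ρ : g →ₗ[k] Module.End k V) (TV : V →ₗ[k] V)
    (h : ∀ (x : g) (v : V), ρ (T x) (TV v) = TV (ρ (T x) v + ρ x (TV v) + lam • ρ x v))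
    (x : g) (v : V) :
    ρ ((2 : k) • T x + lam • x) ((2 : k) • TV v + lam • v) =
      ((2 : k) • TV (ρ ((2 : k) • T x + lam • x) v + ρ x ((2 : k) • TV v + lam • v))
        + lam • (ρ ((2 : k) • T x + lam • x) v + ρ x ((2 : k) • TV v + lam • v)))
        - (lam ^ 2) • ρ x v := by
  simp only [map_add, map_smul, LinearMap.add_apply, LinearMap.smul_apply, h]
  module

/-- If `(V, ρL, ρR, TV)` is a representation of a Rota-Baxter Leibniz algebra
`(g, br, T)` of weight `lam`, then `(V, ρL, ρR, 2 TV + lam • id)` is a representation of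
the modified Rota-Baxter Leibniz algebra `(g, br, 2T + lam • id)` of weight `-lam ^ 2`. -/
theorem statement1 {k : Type*} [Field k] [CharZero k]
    {g : Type*} [AddCommGroup g] [Module k g]
    {V : Type*} [AddCommGroup V] [Module k V]
    (br : g →ₗ[k] g →ₗ[k] g)
    (hLeib : ∀ x y z : g, br x (br y z) = br (br x y) z + br y (br x z))
    (lam : k) (T : g →ₗ[k] g)
    (hT : ∀ x y : g, br (T x) (T y) = T (br (T x) y + br x (T y) + lam • br x y))
    (ρL ρR : g →ₗ[k] Module.End k V)
    (hL : ∀ (x y : g) (v : V), ρL (br x y) v = ρL x (ρL y v) - ρL y (ρL x v))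
    (hR1 : ∀ (x y : g) (v : V), ρR (br x y) v = ρL x (ρR y v) - ρR y (ρL x v))
    (hR2 : ∀ (x y : g) (v : V), ρR (br x y) v = ρL x (ρR y v) + ρR y (ρR x v))
    (TV : V →ₗ[k] V)
    (hTL : ∀ (x : g) (v : V),
      ρL (T x) (TV v) = TV (ρL (T x) v + ρL x (TV v) + lam • ρL x v))
    (hTR : ∀ (x : g) (v : V),
      ρR (T x) (TV v) = TV (ρR (T x) v + ρR x (TV v) + lam • ρR x v)) :
    (∀ (x : g) (v : V),
      ρL ((2 : k) • T x + lam • x) ((2 : k) • TV v + lam • v) =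
        ((2 : k) • TV (ρL ((2 : k) • T x + lam • x) v + ρL x ((2 : k) • TV v + lam • v))
          + lam • (ρL ((2 : k) • T x + lam • x) v + ρL x ((2 : k) • TV v + lam • v)))
          - (lam ^ 2) • ρL x v) ∧
    (∀ (x : g) (v : V),
      ρR ((2 : k) • T x + lam • x) ((2 : k) • TV v + lam • v) =
        ((2 : k) • TV (ρR ((2 : k) • T x + lam • x) v + ρR x ((2 : k) • TV v + lam • v))
          + lam • (ρR ((2 : k) • T x + lam • x) v + ρR x ((2 : k) • TV v + lam • v)))
          - (lam ^ 2) • ρR x v) := by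
  exact ⟨modified_rotaBaxter_of_rotaBaxter lam T ρL TV hTL,
    modified_rotaBaxter_of_rotaBaxter lam T ρR TV hTR⟩
end

section
/- Let (g,[·,·],K) be a modified Rota-Baxter Leibniz algebra of weight λ over a field k of characteristic 0 and let (V,ρL,ρR,K_V) be a representation of it. Then the direct sum g ⊕ V equipped with the semidirect product bracket [(x,u),(y,v)] := ([x,y], ρL(x)v + ρR(y)u) is a Leibniz algebra, and the linear map K ⊕ K_V : (x,u) ↦ (K x, K_V u) is a modified Rota-Baxter operator of weight λ on it; hence (g ⊕ V, [·,·], K ⊕ K_V) is a modified Rota-Baxter Leibniz algebra of weight λ. -/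
/-- The semidirect product `g ⊕ V` of a modified Rota-Baxter Leibniz algebra `(g, br, K)`
of weight `lam` with a representation `(V, ρL, ρR, KV)` is a Leibniz algebra, and
`K ⊕ KV` is a modified Rota-Baxter operator of weight `lam` on it. -/
theorem statement2 {k : Type*} [Field k] [CharZero k]
    {g : Type*} [AddCommGroup g] [Module k g]
    {V : Type*} [AddCommGroup V] [Module k V]
    (br : g →ₗ[k] g →ₗ[k] g)
    (hLeib : ∀ x y z : g, br x (br y z) = br (br x y) z + br y (br x z))
    (lam : k) (K : g →ₗ[k] g)
    (hK : ∀ x y : g, br (K x) (K y) = K (br (K x) y + br x (K y)) + lam • br x y)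
    (ρL ρR : g →ₗ[k] Module.End k V)
    (hL : ∀ (x y : g) (v : V), ρL (br x y) v = ρL x (ρL y v) - ρL y (ρL x v))
    (hR1 : ∀ (x y : g) (v : V), ρR (br x y) v = ρL x (ρR y v) - ρR y (ρL x v))
    (hR2 : ∀ (x y : g) (v : V), ρR (br x y) v = ρL x (ρR y v) + ρR y (ρR x v))
    (KV : V →ₗ[k] V)
    (hKVL : ∀ (x : g) (v : V),
      ρL (K x) (KV v) = KV (ρL (K x) v + ρL x (KV v)) + lam • ρL x v)
    (hKVR : ∀ (x : g) (v : V),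
      ρR (K x) (KV v) = KV (ρR (K x) v + ρR x (KV v)) + lam • ρR x v)
    (brP : g × V → g × V → g × V)
    (hbrP : ∀ a b : g × V, brP a b = (br a.1 b.1, ρL a.1 b.2 + ρR b.1 a.2))
    (KP : g × V → g × V)
    (hKP : ∀ a : g × V, KP a = (K a.1, KV a.2)) :
    (∀ a b c : g × V, brP a (brP b c) = brP (brP a b) c + brP b (brP a c)) ∧
    (∀ a b : g × V,
      brP (KP a) (KP b) = KP (brP (KP a) b + brP a (KP b)) + lam • brP a b) := by
  refine ⟨fun a b c => ?_, fun a b => ?_⟩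
  · simp only [hbrP]
    ext1
    · exact hLeib a.1 b.1 c.1
    · simp only [Prod.snd_add, map_add]
      rw [hR2 b.1 c.1, hL, hR1 a.1 c.1]
      abel
  · simp only [hKP, hbrP]
    ext1
    · exact hK a.1 b.1
    · simp only [Prod.fst_add, Prod.snd_add, Prod.smul_snd, hKVL, hKVR, map_add, smul_add]
      abel
end

section
/- Let (g,[·,·],K) be a modified Rota-Baxter Leibniz algebra of weight λ over a field k of characteristic 0. Define a new bilinear operation on g by [x,y]_K := [K x, y] + [x, K y]. Then (g, [·,·]_K) is a Leibniz algebra, i.e. [x,[y,z]_K]_K = [[x,y]_K, z]_K + [y,[x,z]_K]_K for all x,y,z ∈ g. -/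
/-- Given a modified Rota-Baxter Leibniz algebra `(g, br, K)` of weight `lam`, the
induced bracket `[x,y]_K = [K x, y] + [x, K y]` makes `g` into a Leibniz algebra. -/
theorem statement3 {k : Type*} [Field k] [CharZero k]
    {g : Type*} [AddCommGroup g] [Module k g]
    (br : g →ₗ[k] g →ₗ[k] g)
    (hLeib : ∀ x y z : g, br x (br y z) = br (br x y) z + br y (br x z))
    (lam : k) (K : g →ₗ[k] g)
    (hK : ∀ x y : g, br (K x) (K y) = K (br (K x) y + br x (K y)) + lam • br x y)
    (brK : g → g → g)
    (hbrK : ∀ x y : g, brK x y = br (K x) y + br x (K y)) :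
    ∀ x y z : g, brK x (brK y z) = brK (brK x y) z + brK y (brK x z) := by
  have hKbr (x y : g) : K (br (K x) y + br x (K y)) = br (K x) (K y) - lam • br x y := by
    rw [hK, add_sub_cancel_right]
  intro x y z
  simp only [hbrK, hKbr]
  simp only [map_add, map_sub, map_smul, LinearMap.add_apply, LinearMap.sub_apply,
    LinearMap.smul_apply]
  rw [hLeib (K x) (K y) z, hLeib (K x) y (K z), hLeib x (K y) (K z), hLeib x y z, smul_add]
  abel
end

section
/- Let (g,[·,·],K) be a modified Rota-Baxter Leibniz algebra of weight λ over a field k of characteristic 0 and let [x,y]_K := [K x, y] + [x, K y]. Then K is a modified Rota-Baxter operator of weight λ on the Leibniz algebra (g,[·,·]_K), i.e. [K x, K y]_K = K([K x, y]_K + [x, K y]_K) + λ[x,y]_K for all x,y ∈ g. -/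
/-- Given a modified Rota-Baxter Leibniz algebra `(g, br, K)` of weight `lam`, the map
`K` is again a modified Rota-Baxter operator of weight `lam` on the induced Leibniz
algebra `(g, [·,·]_K)` where `[x,y]_K = [K x, y] + [x, K y]`. -/
theorem statement4 {k : Type*} [Field k] [CharZero k]
    {g : Type*} [AddCommGroup g] [Module k g]
    (br : g →ₗ[k] g →ₗ[k] g)
    (hLeib : ∀ x y z : g, br x (br y z) = br (br x y) z + br y (br x z))
    (lam : k) (K : g →ₗ[k] g)
    (hK : ∀ x y : g, br (K x) (K y) = K (br (K x) y + br x (K y)) + lam • br x y)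
    (brK : g → g → g)
    (hbrK : ∀ x y : g, brK x y = br (K x) y + br x (K y)) :
    ∀ x y : g, brK (K x) (K y) = K (brK (K x) y + brK x (K y)) + lam • brK x y := by
  intro x y
  simp only [hbrK]
  rw [hK (K x) y, hK x (K y)]
  simp only [map_add, smul_add]
  abel
end

section
/- Let (g,[·,·],K) be a modified Rota-Baxter Leibniz algebra of weight λ over a field k of characteristic 0 and let (V,ρL,ρR,K_V) be a representation of it. Define ρL_K, ρR_K : g → End(V) by ρL_K(x)v := ρL(K x)v − K_V(ρL(x)v) and ρR_K(x)v := ρR(K x)v − K_V(ρR(x)v). Then (V, ρL_K, ρR_K) is a representation of the Leibniz algebra (g,[·,·]_K) where [x,y]_K := [K x, y] + [x, K y]; that is, ρL_K([x,y]_K) = ρL_K(x)ρL_K(y) − ρL_K(y)ρL_K(x), ρR_K([x,y]_K) = ρL_K(x)ρR_K(y) − ρR_K(y)ρL_K(x), and ρR_K([x,y]_K) = ρL_K(x)ρR_K(y) + ρR_K(y)ρR_K(x) for all x,y ∈ g. -/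
/-- The composite of the twisted actions `A (K x) - KV ∘ A x` and `B (K y) - KV ∘ B y`, when `A`
satisfies the modified Rota-Baxter compatibility with `KV`. -/
theorem twisted_action_comp {k : Type*} [CommRing k]
    {g : Type*} [AddCommGroup g] [Module k g]
    {V : Type*} [AddCommGroup V] [Module k V]
    (K : g →ₗ[k] g) (KV : V →ₗ[k] V) (lam : k) (A B : g →ₗ[k] Module.End k V)
    (hA : ∀ (x : g) (v : V), A (K x) (KV v) = KV (A (K x) v + A x (KV v)) + lam • A x v)
    (x y : g) (v : V) :
    A (K x) (B (K y) v - KV (B y v)) - KV (A x (B (K y) v - KV (B y v))) =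
      A (K x) (B (K y) v) - KV (A (K x) (B y v) + A x (B (K y) v)) - lam • A x (B y v) := by
  simp only [map_sub, hA, map_add]
  abel

/-- Given a modified Rota-Baxter Leibniz algebra `(g, br, K)` of weight `lam` and a
representation `(V, ρL, ρR, KV)`, the maps `ρLK x v = ρL (K x) v - KV (ρL x v)` and
`ρRK x v = ρR (K x) v - KV (ρR x v)` make `V` a representation of the induced Leibniz
algebra `(g, [·,·]_K)`. -/
theorem statement5 {k : Type*} [Field k] [CharZero k]
    {g : Type*} [AddCommGroup g] [Module k g]
    {V : Type*} [AddCommGroup V] [Module k V]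
    (br : g →ₗ[k] g →ₗ[k] g)
    (hLeib : ∀ x y z : g, br x (br y z) = br (br x y) z + br y (br x z))
    (lam : k) (K : g →ₗ[k] g)
    (hK : ∀ x y : g, br (K x) (K y) = K (br (K x) y + br x (K y)) + lam • br x y)
    (ρL ρR : g →ₗ[k] Module.End k V)
    (hL : ∀ (x y : g) (v : V), ρL (br x y) v = ρL x (ρL y v) - ρL y (ρL x v))
    (hR1 : ∀ (x y : g) (v : V), ρR (br x y) v = ρL x (ρR y v) - ρR y (ρL x v))
    (hR2 : ∀ (x y : g) (v : V), ρR (br x y) v = ρL x (ρR y v) + ρR y (ρR x v))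
    (KV : V →ₗ[k] V)
    (hKVL : ∀ (x : g) (v : V),
      ρL (K x) (KV v) = KV (ρL (K x) v + ρL x (KV v)) + lam • ρL x v)
    (hKVR : ∀ (x : g) (v : V),
      ρR (K x) (KV v) = KV (ρR (K x) v + ρR x (KV v)) + lam • ρR x v)
    (brK : g → g → g)
    (hbrK : ∀ x y : g, brK x y = br (K x) y + br x (K y))
    (ρLK ρRK : g → V → V)
    (hρLK : ∀ (x : g) (v : V), ρLK x v = ρL (K x) v - KV (ρL x v))
    (hρRK : ∀ (x : g) (v : V), ρRK x v = ρR (K x) v - KV (ρR x v)) :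
    (∀ (x y : g) (v : V), ρLK (brK x y) v = ρLK x (ρLK y v) - ρLK y (ρLK x v)) ∧
    (∀ (x y : g) (v : V), ρRK (brK x y) v = ρLK x (ρRK y v) - ρRK y (ρLK x v)) ∧
    (∀ (x y : g) (v : V), ρRK (brK x y) v = ρLK x (ρRK y v) + ρRK y (ρRK x v)) := by
  have hKbr : ∀ x y : g, K (brK x y) = br (K x) (K y) - lam • br x y := fun x y => by
    rw [hbrK, hK, add_sub_cancel_right]
  have hLL := twisted_action_comp K KV lam ρL ρL hKVL
  have hLR := twisted_action_comp K KV lam ρL ρR hKVL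
  have hRL := twisted_action_comp K KV lam ρR ρL hKVR
  have hRR := twisted_action_comp K KV lam ρR ρR hKVR
  refine ⟨fun x y v => ?_, fun x y v => ?_, fun x y v => ?_⟩
  · simp only [hρLK, hLL, hKbr]
    simp only [hbrK, map_add, map_sub, map_smul, LinearMap.add_apply, LinearMap.sub_apply,
      LinearMap.smul_apply, hL, smul_sub]
    abel
  · simp only [hρLK, hρRK, hLR, hRL, hKbr]
    simp only [hbrK, map_add, map_sub, map_smul, LinearMap.add_apply, LinearMap.sub_apply,
      LinearMap.smul_apply, hR1, smul_sub]
    abel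
  · simp only [hρLK, hρRK, hLR, hRR, hKbr]
    simp only [hbrK, map_add, map_sub, map_smul, LinearMap.add_apply, LinearMap.sub_apply,
      LinearMap.smul_apply, hR2, smul_add]
    abel
end

section
/- Let (g,[·,·],K) be a modified Rota-Baxter Leibniz algebra of weight λ over a field k of characteristic 0 and let (V,ρL,ρR,K_V) be a representation of it. Define ρL_K(x)v := ρL(K x)v − K_V(ρL(x)v) and ρR_K(x)v := ρR(K x)v − K_V(ρR(x)v). Then (V, ρL_K, ρR_K, K_V) is a representation of the modified Rota-Baxter Leibniz algebra (g,[·,·]_K,K) of weight λ; in particular, for all x ∈ g and v ∈ V: ρL_K(K x)(K_V v) = K_V(ρL_K(K x)v + ρL_K(x)(K_V v)) + λ ρL_K(x)v and ρR_K(K x)(K_V v) = K_V(ρR_K(K x)v + ρR_K(x)(K_V v)) + λ ρR_K(x)v. -/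
/-- Composing two twisted actions `ρ (K x) - KV ∘ ρ x`, the outer of which is compatible
with `KV`. -/
theorem twisted_comp {k : Type*} [Field k]
    {g : Type*} [AddCommGroup g] [Module k g]
    {V : Type*} [AddCommGroup V] [Module k V]
    (lam : k) (K : g →ₗ[k] g) (ρ σ : g →ₗ[k] Module.End k V) (KV : V →ₗ[k] V)
    (h : ∀ (x : g) (v : V), ρ (K x) (KV v) = KV (ρ (K x) v + ρ x (KV v)) + lam • ρ x v)
    (x y : g) (v : V) :
    ρ (K x) (σ (K y) v - KV (σ y v)) - KV (ρ x (σ (K y) v - KV (σ y v))) =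
      ρ (K x) (σ (K y) v) - KV (ρ (K x) (σ y v) + ρ x (σ (K y) v)) - lam • ρ x (σ y v) := by
  simp only [map_sub, h, map_add]
  abel

/-- The twisted action `ρ (K x) - KV ∘ ρ x` is again compatible with `KV`. -/
theorem twisted_compatible {k : Type*} [Field k]
    {g : Type*} [AddCommGroup g] [Module k g]
    {V : Type*} [AddCommGroup V] [Module k V]
    (lam : k) (K : g →ₗ[k] g) (ρ : g →ₗ[k] Module.End k V) (KV : V →ₗ[k] V)
    (h : ∀ (x : g) (v : V), ρ (K x) (KV v) = KV (ρ (K x) v + ρ x (KV v)) + lam • ρ x v)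
    (x : g) (v : V) :
    ρ (K (K x)) (KV v) - KV (ρ (K x) (KV v)) =
      KV (ρ (K (K x)) v - KV (ρ (K x) v) + (ρ (K x) (KV v) - KV (ρ x (KV v)))) +
        lam • (ρ (K x) v - KV (ρ x v)) := by
  simp only [h, map_sub, map_add, map_smul, smul_sub]
  abel

/-- The twisted action of the induced bracket. -/
theorem twisted_induced_bracket {k : Type*} [Field k]
    {g : Type*} [AddCommGroup g] [Module k g]
    {V : Type*} [AddCommGroup V] [Module k V]
    (br : g →ₗ[k] g →ₗ[k] g) (lam : k) (K : g →ₗ[k] g)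
    (hK : ∀ x y : g, br (K x) (K y) = K (br (K x) y + br x (K y)) + lam • br x y)
    (ρ : g →ₗ[k] Module.End k V) (KV : V →ₗ[k] V) (x y : g) (v : V) :
    ρ (K (br (K x) y + br x (K y))) v - KV (ρ (br (K x) y + br x (K y)) v) =
      ρ (br (K x) (K y)) v - lam • ρ (br x y) v -
        KV (ρ (br (K x) y) v + ρ (br x (K y)) v) := by
  rw [← sub_eq_of_eq_add (hK x y)]
  simp only [map_sub, map_add, map_smul, LinearMap.sub_apply, LinearMap.add_apply,
    LinearMap.smul_apply]

/-- Given a modified Rota-Baxter Leibniz algebra `(g, br, K)` of weight `lam` and a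
representation `(V, ρL, ρR, KV)`, the quadruple `(V, ρLK, ρRK, KV)` with
`ρLK x v = ρL (K x) v - KV (ρL x v)` and `ρRK x v = ρR (K x) v - KV (ρR x v)` is a
representation of the modified Rota-Baxter Leibniz algebra `(g, [·,·]_K, K)` of weight
`lam`. -/
theorem statement6 {k : Type*} [Field k] [CharZero k]
    {g : Type*} [AddCommGroup g] [Module k g]
    {V : Type*} [AddCommGroup V] [Module k V]
    (br : g →ₗ[k] g →ₗ[k] g)
    (hLeib : ∀ x y z : g, br x (br y z) = br (br x y) z + br y (br x z))
    (lam : k) (K : g →ₗ[k] g)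
    (hK : ∀ x y : g, br (K x) (K y) = K (br (K x) y + br x (K y)) + lam • br x y)
    (ρL ρR : g →ₗ[k] Module.End k V)
    (hL : ∀ (x y : g) (v : V), ρL (br x y) v = ρL x (ρL y v) - ρL y (ρL x v))
    (hR1 : ∀ (x y : g) (v : V), ρR (br x y) v = ρL x (ρR y v) - ρR y (ρL x v))
    (hR2 : ∀ (x y : g) (v : V), ρR (br x y) v = ρL x (ρR y v) + ρR y (ρR x v))
    (KV : V →ₗ[k] V)
    (hKVL : ∀ (x : g) (v : V),
      ρL (K x) (KV v) = KV (ρL (K x) v + ρL x (KV v)) + lam • ρL x v)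
    (hKVR : ∀ (x : g) (v : V),
      ρR (K x) (KV v) = KV (ρR (K x) v + ρR x (KV v)) + lam • ρR x v)
    (brK : g → g → g)
    (hbrK : ∀ x y : g, brK x y = br (K x) y + br x (K y))
    (ρLK ρRK : g → V → V)
    (hρLK : ∀ (x : g) (v : V), ρLK x v = ρL (K x) v - KV (ρL x v))
    (hρRK : ∀ (x : g) (v : V), ρRK x v = ρR (K x) v - KV (ρR x v)) :
    (∀ (x y : g) (v : V), ρLK (brK x y) v = ρLK x (ρLK y v) - ρLK y (ρLK x v)) ∧
    (∀ (x y : g) (v : V), ρRK (brK x y) v = ρLK x (ρRK y v) - ρRK y (ρLK x v)) ∧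
    (∀ (x y : g) (v : V), ρRK (brK x y) v = ρLK x (ρRK y v) + ρRK y (ρRK x v)) ∧
    (∀ (x : g) (v : V),
      ρLK (K x) (KV v) = KV (ρLK (K x) v + ρLK x (KV v)) + lam • ρLK x v) ∧
    (∀ (x : g) (v : V),
      ρRK (K x) (KV v) = KV (ρRK (K x) v + ρRK x (KV v)) + lam • ρRK x v) := by
  refine ⟨fun x y v => ?_, fun x y v => ?_, fun x y v => ?_, fun x v => ?_, fun x v => ?_⟩
  · simp only [hρLK, hbrK]
    rw [twisted_induced_bracket br lam K hK, twisted_comp lam K ρL ρL KV hKVL,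
      twisted_comp lam K ρL ρL KV hKVL]
    simp only [hL, map_add, map_sub, smul_sub]
    abel
  · simp only [hρLK, hρRK, hbrK]
    rw [twisted_induced_bracket br lam K hK, twisted_comp lam K ρL ρR KV hKVL,
      twisted_comp lam K ρR ρL KV hKVR]
    simp only [hR1, map_add, map_sub, smul_sub]
    abel
  · simp only [hρLK, hρRK, hbrK]
    rw [twisted_induced_bracket br lam K hK, twisted_comp lam K ρL ρR KV hKVL,
      twisted_comp lam K ρR ρR KV hKVR]
    simp only [hR2, map_add, smul_add]
    abel
  · simp only [hρLK]
    exact twisted_compatible lam K ρL KV hKVL x v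
  · simp only [hρRK]
    exact twisted_compatible lam K ρR KV hKVR x v
end

section
/- Let k be a field of characteristic 0 and let g = k³ with basis e₁, e₂, e₃ and the bilinear bracket determined by [e₁,e₁] = e₃ and all other brackets of basis vectors equal to zero (this is a Leibniz algebra). Let K : g → g be the linear map with matrix entries a_{ij} (so K e_j = Σ_i a_{ij} e_i). If a₁₂ = a₁₃ = 0 and a₁₁·a₂₃ = 0, then K is a modified Rota-Baxter operator of weight a₁₁² − 2·a₁₁·a₃₃ on g. -/
/-- On the 3-dimensional Leibniz algebra with `[e₁,e₁] = e₃` (all other products of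
basis vectors zero), a matrix `A` with `a₁₂ = a₁₃ = 0` and `a₁₁ a₂₃ = 0` defines a
modified Rota-Baxter operator of weight `a₁₁² - 2 a₁₁ a₃₃`.  (Indices are shifted by one:
`aᵢⱼ = A (i-1) (j-1)`, the basis is `e i = Pi.single i 1`, and `K` acts by `A.mulVec`,
so that `K eⱼ = ∑ᵢ aᵢⱼ eᵢ`.) -/
theorem statement7 {k : Type*} [Field k] [CharZero k]
    (A : Matrix (Fin 3) (Fin 3) k)
    (br : (Fin 3 → k) → (Fin 3 → k) → (Fin 3 → k))
    (hbr : ∀ x y : Fin 3 → k, br x y = (x 0 * y 0) • (Pi.single (2 : Fin 3) (1 : k) : Fin 3 → k))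
    (h12 : A 0 1 = 0) (h13 : A 0 2 = 0) (h1123 : A 0 0 * A 1 2 = 0) :
    ∀ x y : Fin 3 → k,
      br (A.mulVec x) (A.mulVec y) =
        A.mulVec (br (A.mulVec x) y + br x (A.mulVec y))
          + (A 0 0 ^ 2 - 2 * A 0 0 * A 2 2) • br x y := by
  intro x y
  have hK : ∀ v : Fin 3 → k, A.mulVec v 0 = A 0 0 * v 0 := fun v => by
    simp [Matrix.mulVec, dotProduct, Fin.sum_univ_three, h12, h13]
  simp only [hbr, hK, ← add_smul, Matrix.mulVec_smul, Matrix.mulVec_single_one]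
  ext i
  fin_cases i
  · simp [h13]
  · simp [-mul_eq_zero, -zero_eq_mul]
    linear_combination (-2 * x 0 * y 0) * h1123
  · simp
    ring
end

section
/- Let 0 → V →ⁱ ĝ →ᵖ g → 0 be an abelian extension of modified Rota-Baxter Leibniz algebras of weight λ over a field k of characteristic 0, and let s : g → ĝ be a section of p (a linear map with p ∘ s = id_g). For x ∈ g and v ∈ V, the elements [s(x), i(v)]_ĝ and [i(v), s(x)]_ĝ lie in the image of i, so there are unique ρL(x)v, ρR(x)v ∈ V with i(ρL(x)v) = [s(x), i(v)]_ĝ and i(ρR(x)v) = [i(v), s(x)]_ĝ. Then (V, ρL, ρR, K_V) is a representation of the modified Rota-Baxter Leibniz algebra (g,[·,·]_g,K) of weight λ. -/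
/-- Given an abelian extension `0 → V → ĝ → g → 0` of modified Rota-Baxter Leibniz
algebras of weight `lam` and a section `s` of `p`, the induced maps
`ρL x v` and `ρR x v` (characterized by `i (ρL x v) = [s x, i v]` and
`i (ρR x v) = [i v, s x]`) make `(V, ρL, ρR, KV)` a representation of the modified
Rota-Baxter Leibniz algebra `(g, br_g, K)` of weight `lam`. -/
theorem statement10 {k : Type*} [Field k] [CharZero k]
    {g : Type*} [AddCommGroup g] [Module k g]
    {gh : Type*} [AddCommGroup gh] [Module k gh]
    {V : Type*} [AddCommGroup V] [Module k V]
    (brg : g →ₗ[k] g →ₗ[k] g)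
    (hLg : ∀ x y z : g, brg x (brg y z) = brg (brg x y) z + brg y (brg x z))
    (brh : gh →ₗ[k] gh →ₗ[k] gh)
    (hLh : ∀ a b c : gh, brh a (brh b c) = brh (brh a b) c + brh b (brh a c))
    (lam : k) (K : g →ₗ[k] g)
    (hK : ∀ x y : g, brg (K x) (K y) = K (brg (K x) y + brg x (K y)) + lam • brg x y)
    (Kh : gh →ₗ[k] gh)
    (hKh : ∀ a b : gh, brh (Kh a) (Kh b) = Kh (brh (Kh a) b + brh a (Kh b)) + lam • brh a b)
    (KV : V →ₗ[k] V)
    (i : V →ₗ[k] gh) (p : gh →ₗ[k] g)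
    (hab : ∀ u v : V, brh (i u) (i v) = 0)
    (hphom : ∀ a b : gh, p (brh a b) = brg (p a) (p b))
    (hiK : ∀ v : V, Kh (i v) = i (KV v))
    (hpK : ∀ a : gh, p (Kh a) = K (p a))
    (hinj : Function.Injective i) (hsurj : Function.Surjective p)
    (hker : LinearMap.ker p = LinearMap.range i)
    (s : g →ₗ[k] gh) (hs : ∀ x : g, p (s x) = x)
    (ρL ρR : g → V → V)
    (hρL : ∀ (x : g) (v : V), i (ρL x v) = brh (s x) (i v))
    (hρR : ∀ (x : g) (v : V), i (ρR x v) = brh (i v) (s x)) :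
    (∀ (x y : g) (v : V), ρL (brg x y) v = ρL x (ρL y v) - ρL y (ρL x v)) ∧
    (∀ (x y : g) (v : V), ρR (brg x y) v = ρL x (ρR y v) - ρR y (ρL x v)) ∧
    (∀ (x y : g) (v : V), ρR (brg x y) v = ρL x (ρR y v) + ρR y (ρR x v)) ∧
    (∀ (x : g) (v : V),
      ρL (K x) (KV v) = KV (ρL (K x) v + ρL x (KV v)) + lam • ρL x v) ∧
    (∀ (x : g) (v : V),
      ρR (K x) (KV v) = KV (ρR (K x) v + ρR x (KV v)) + lam • ρR x v) := by
  have eq_add_of_proj_eq : ∀ a b : gh, p a = p b → ∃ w, a = b + i w := by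
    intro a b h
    have hmem : a - b ∈ LinearMap.range i := by
      rw [← hker, LinearMap.mem_ker, map_sub, h, sub_self]
    obtain ⟨w, hw⟩ := hmem
    exact ⟨w, by rw [hw, add_sub_cancel]⟩
  have left_congr : ∀ (a b : gh) (v : V), p a = p b → brh a (i v) = brh b (i v) := by
    intro a b v h
    obtain ⟨w, rfl⟩ := eq_add_of_proj_eq a b h
    rw [map_add, LinearMap.add_apply, hab, add_zero]
  have right_congr : ∀ (a b : gh) (v : V), p a = p b → brh (i v) a = brh (i v) b := by
    intro a b v h
    obtain ⟨w, rfl⟩ := eq_add_of_proj_eq a b h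
    rw [map_add, hab, add_zero]
  have hs_br : ∀ x y : g, p (s (brg x y)) = p (brh (s x) (s y)) := by
    intro x y
    rw [hs, hphom, hs, hs]
  have hs_K : ∀ x : g, p (s (K x)) = p (Kh (s x)) := by
    intro x
    rw [hs, hpK, hs]
  refine ⟨fun x y v => hinj ?_, fun x y v => hinj ?_, fun x y v => hinj ?_,
    fun x v => hinj ?_, fun x v => hinj ?_⟩
  · rw [map_sub, hρL, hρL, hρL, hρL, hρL, left_congr _ _ _ (hs_br x y), hLh (s x) (s y),
      add_sub_cancel_right]
  · rw [map_sub, hρR, hρL, hρR, hρR, hρL, right_congr _ _ _ (hs_br x y), hLh (s x) (i v),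
      add_sub_cancel_left]
  · rw [map_add, hρR, hρL, hρR, hρR, hρR, right_congr _ _ _ (hs_br x y), hLh (i v) (s x),
      add_comm]
  · rw [map_add, ← hiK, map_add, map_smul, hρL, hρL, hρL, hρL, left_congr _ _ _ (hs_K x),
      left_congr _ _ _ (hs_K x), ← hiK, hKh]
  · rw [map_add, ← hiK, map_add, map_smul, hρR, hρR, hρR, hρR, right_congr _ _ _ (hs_K x),
      right_congr _ _ _ (hs_K x), ← hiK, hKh, add_comm (brh (Kh (i v)) (s x))]
end

section
/- Let 0 → V →ⁱ ĝ →ᵖ g → 0 be an abelian extension of modified Rota-Baxter Leibniz algebras of weight λ over a field k of characteristic 0, let s : g → ĝ be a section of p, and let (V,ρL,ρR,K_V) be the induced representation (i(ρL(x)v) = [s(x), i(v)]_ĝ, i(ρR(x)v) = [i(v), s(x)]_ĝ). Define ψ : g × g → V and χ : g → V by i(ψ(x,y)) = [s(x), s(y)]_ĝ − s([x,y]_g) and i(χ(x)) = K̂(s(x)) − s(K(x)). Then for all x,y,z ∈ g: (a) ψ(x,[y,z]_g) + ρL(x)ψ(y,z) = ρL(y)ψ(x,z) + ρR(z)ψ(x,y)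 + ψ([x,y]_g, z) + ψ(y,[x,z]_g); and (b) ψ(K x, K y) + ρL(K x)χ(y) + ρR(K y)χ(x) = χ([K x, y]_g + [x, K y]_g) + K_V( ψ(K x, y) + ψ(x, K y) + ρL(x)χ(y) + ρR(y)χ(x) ) + λ ψ(x,y). -/
/-- Given an abelian extension `0 → V → ĝ → g → 0` of modified Rota-Baxter Leibniz
algebras of weight `lam` and a section `s` of `p`, the pair `(ψ, χ)` defined by
`i (ψ x y) = [s x, s y] - s [x,y]` and `i (χ x) = K̂ (s x) - s (K x)` is a 2-cocycle of
`(g, br_g, K)` with coefficients in the induced representation `(V, ρL, ρR, KV)`. -/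
theorem statement11 {k : Type*} [Field k] [CharZero k]
    {g : Type*} [AddCommGroup g] [Module k g]
    {gh : Type*} [AddCommGroup gh] [Module k gh]
    {V : Type*} [AddCommGroup V] [Module k V]
    (brg : g →ₗ[k] g →ₗ[k] g)
    (hLg : ∀ x y z : g, brg x (brg y z) = brg (brg x y) z + brg y (brg x z))
    (brh : gh →ₗ[k] gh →ₗ[k] gh)
    (hLh : ∀ a b c : gh, brh a (brh b c) = brh (brh a b) c + brh b (brh a c))
    (lam : k) (K : g →ₗ[k] g)
    (hK : ∀ x y : g, brg (K x) (K y) = K (brg (K x) y + brg x (K y)) + lam • brg x y)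
    (Kh : gh →ₗ[k] gh)
    (hKh : ∀ a b : gh, brh (Kh a) (Kh b) = Kh (brh (Kh a) b + brh a (Kh b)) + lam • brh a b)
    (KV : V →ₗ[k] V)
    (i : V →ₗ[k] gh) (p : gh →ₗ[k] g)
    (hab : ∀ u v : V, brh (i u) (i v) = 0)
    (hphom : ∀ a b : gh, p (brh a b) = brg (p a) (p b))
    (hiK : ∀ v : V, Kh (i v) = i (KV v))
    (hpK : ∀ a : gh, p (Kh a) = K (p a))
    (hinj : Function.Injective i) (hsurj : Function.Surjective p)
    (hker : LinearMap.ker p = LinearMap.range i)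
    (s : g →ₗ[k] gh) (hs : ∀ x : g, p (s x) = x)
    (ρL ρR : g → V → V)
    (hρL : ∀ (x : g) (v : V), i (ρL x v) = brh (s x) (i v))
    (hρR : ∀ (x : g) (v : V), i (ρR x v) = brh (i v) (s x))
    (ψ : g → g → V)
    (hψ : ∀ x y : g, i (ψ x y) = brh (s x) (s y) - s (brg x y))
    (χ : g → V)
    (hχ : ∀ x : g, i (χ x) = Kh (s x) - s (K x)) :
    (∀ x y z : g,
      ψ x (brg y z) + ρL x (ψ y z) =
        ρL y (ψ x z) + ρR z (ψ x y) + ψ (brg x y) z + ψ y (brg x z)) ∧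
    (∀ x y : g,
      ψ (K x) (K y) + ρL (K x) (χ y) + ρR (K y) (χ x) =
        χ (brg (K x) y + brg x (K y))
          + KV (ψ (K x) y + ψ x (K y) + ρL x (χ y) + ρR y (χ x))
          + lam • ψ x y) := by
  refine ⟨fun x y z => hinj ?_, fun x y => hinj ?_⟩
  · simp only [map_add, hψ, hρL, hρR, map_sub, LinearMap.sub_apply, hLh (s x) (s y) (s z),
      hLg x y z]
    abel
  · have h_lift : ∀ w : g, Kh (s w) = s (K w) + i (χ w) := fun w => by rw [hχ]; abel
    have h_rb := hKh (s x) (s y)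
    rw [h_lift x, h_lift y] at h_rb
    simp only [map_add, LinearMap.add_apply, hab, add_zero] at h_rb
    have h_lhs : brh (s (K x)) (s (K y)) =
        Kh (brh (s (K x)) (s y)) + Kh (brh (i (χ x)) (s y)) +
          (Kh (brh (s x) (s (K y))) + Kh (brh (s x) (i (χ y)))) + lam • brh (s x) (s y) -
          brh (i (χ x)) (s (K y)) - brh (s (K x)) (i (χ y)) := by
      rw [← h_rb]
      abel
    simp only [map_add, map_smul, ← hiK, hχ (brg (K x) y + brg x (K y)), hψ, hρL, hρR, map_sub,
      hK x y, smul_sub]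
    rw [h_lhs]
    abel
end

section
/- Let (g,[·,·],K) be a modified Rota-Baxter Leibniz algebra of weight λ over a field k of characteristic 0 and let (V,ρL,ρR,K_V) be a representation of it. Given a bilinear map ψ : g × g → V and a linear map χ : g → V, define on g ⊕ V the bracket [(x,u),(y,v)]_ψ := ([x,y], ρL(x)v + ρR(y)u + ψ(x,y)) and the linear map K_χ(x,u) := (K x, χ(x) + K_V u). Then (g ⊕ V, [·,·]_ψ, K_χ) is a modified Rota-Baxter Leibniz algebra of weight λ if and only if for all x,y,z ∈ g: (a) ψ(x,[y,z]) + ρL(x)ψ(y,z) = ρL(y)ψ(x,z) + ρR(z)ψ(x,y) + ψ([x,y], z) + ψ(y,[x,z]); and (b) ψ(K x, K y) + ρL(K x)χ(y) + ρR(K y)χ(x) = χ([K x, y] + [x, K y]) + K_V( ψ(K x, y) + ψ(x, K y) + ρL(x)χ(y) + ρR(y)χ(x) ) + λ ψ(x,y). -/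
/-- Given a modified Rota-Baxter Leibniz algebra `(g, br, K)` of weight `lam`, a
representation `(V, ρL, ρR, KV)`, a bilinear map `ψ` and a linear map `χ`, the space
`g ⊕ V` with bracket `[(x,u),(y,v)] = ([x,y], ρL x v + ρR y u + ψ x y)` and operator
`K_χ (x,u) = (K x, χ x + KV u)` is a modified Rota-Baxter Leibniz algebra of weight
`lam` if and only if `(ψ, χ)` is a 2-cocycle. -/
theorem statement12 {k : Type*} [Field k] [CharZero k]
    {g : Type*} [AddCommGroup g] [Module k g]
    {V : Type*} [AddCommGroup V] [Module k V]
    (br : g →ₗ[k] g →ₗ[k] g)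
    (hLeib : ∀ x y z : g, br x (br y z) = br (br x y) z + br y (br x z))
    (lam : k) (K : g →ₗ[k] g)
    (hK : ∀ x y : g, br (K x) (K y) = K (br (K x) y + br x (K y)) + lam • br x y)
    (ρL ρR : g →ₗ[k] Module.End k V)
    (hL : ∀ (x y : g) (v : V), ρL (br x y) v = ρL x (ρL y v) - ρL y (ρL x v))
    (hR1 : ∀ (x y : g) (v : V), ρR (br x y) v = ρL x (ρR y v) - ρR y (ρL x v))
    (hR2 : ∀ (x y : g) (v : V), ρR (br x y) v = ρL x (ρR y v) + ρR y (ρR x v))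
    (KV : V →ₗ[k] V)
    (hKVL : ∀ (x : g) (v : V),
      ρL (K x) (KV v) = KV (ρL (K x) v + ρL x (KV v)) + lam • ρL x v)
    (hKVR : ∀ (x : g) (v : V),
      ρR (K x) (KV v) = KV (ρR (K x) v + ρR x (KV v)) + lam • ρR x v)
    (ψ : g →ₗ[k] g →ₗ[k] V) (χ : g →ₗ[k] V)
    (brP : g × V → g × V → g × V)
    (hbrP : ∀ a b : g × V,
      brP a b = (br a.1 b.1, ρL a.1 b.2 + ρR b.1 a.2 + ψ a.1 b.1))
    (KP : g × V → g × V)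
    (hKP : ∀ a : g × V, KP a = (K a.1, χ a.1 + KV a.2)) :
    ((∀ a b c : g × V, brP a (brP b c) = brP (brP a b) c + brP b (brP a c)) ∧
      (∀ a b : g × V,
        brP (KP a) (KP b) = KP (brP (KP a) b + brP a (KP b)) + lam • brP a b)) ↔
    ((∀ x y z : g,
        ψ x (br y z) + ρL x (ψ y z) =
          ρL y (ψ x z) + ρR z (ψ x y) + ψ (br x y) z + ψ y (br x z)) ∧
      (∀ x y : g,
        ψ (K x) (K y) + ρL (K x) (χ y) + ρR (K y) (χ x) =
          χ (br (K x) y + br x (K y))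
            + KV (ψ (K x) y + ψ x (K y) + ρL x (χ y) + ρR y (χ x))
            + lam • ψ x y)) := by
  simp only [hbrP, hKP, Prod.forall, Prod.mk_add_mk, Prod.smul_mk, Prod.mk.injEq]
  constructor
  · rintro ⟨hbr, hop⟩
    constructor
    · intro x y z
      have h := (hbr x 0 y 0 z 0).2
      simp only [map_zero, add_zero, zero_add] at h
      rw [add_comm, h]
      abel
    · intro x y
      have h := (hop x 0 y 0).2
      simp only [map_zero, add_zero, zero_add] at h
      rw [add_rotate, h]
      simp only [map_add]
      abel
  · rintro ⟨hψ, hχ⟩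
    constructor
    · intro x u y v z w
      refine ⟨hLeib x y z, ?_⟩
      simp only [map_add]
      linear_combination (norm := module)
        hψ x y z - hL x y w - hR1 x z v + hR2 y z u
    · intro x u y v
      refine ⟨hK x y, ?_⟩
      have h := hχ x y
      have hv := hKVL x v
      have hu := hKVR y u
      simp only [map_add] at h hv hu ⊢
      linear_combination (norm := module) h + hv + hu
end

section
/- Let 0 → V →ⁱ ĝ →ᵖ g → 0 be an abelian extension of modified Rota-Baxter Leibniz algebras of weight λ over a field k of characteristic 0, let s₁, s₂ : g → ĝ be two sections of p, and let (ψ₁,χ₁) and (ψ₂,χ₂) be the associated 2-cocycles (i(ψ_a(x,y)) = [s_a(x), s_a(y)]_ĝ − s_a([x,y]_g), i(χ_a(x)) = K̂(s_a(x)) − s_a(K(x)) for a = 1,2). Let γ : g → V be the linear map with i(γ(x)) = s₁(x) − s₂(x), and let (V,ρL,ρR,K_V) be the induced representation. Then for all x,y ∈ g: ψ₁(x,y) = ψ₂(x,y) + ρL(x)γ(y) + ρR(y)γ(x) − γ([x,y]_g) and χ₁(x) = χ₂(x) + K_V(γ(x)) − γ(K(x)); that is, (ψ₁,χ₁) and (ψ₂,χ₂)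 differ by the coboundary of γ and hence are cohomologous. -/
/-- The 2-cocycles associated to two different sections of an abelian extension of
modified Rota-Baxter Leibniz algebras differ by the coboundary of
`γ = s₁ - s₂ : g → V`, hence are cohomologous. -/
theorem statement14 {k : Type*} [Field k] [CharZero k]
    {g : Type*} [AddCommGroup g] [Module k g]
    {gh : Type*} [AddCommGroup gh] [Module k gh]
    {V : Type*} [AddCommGroup V] [Module k V]
    (brg : g →ₗ[k] g →ₗ[k] g)
    (hLg : ∀ x y z : g, brg x (brg y z) = brg (brg x y) z + brg y (brg x z))
    (brh : gh →ₗ[k] gh →ₗ[k] gh)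
    (hLh : ∀ a b c : gh, brh a (brh b c) = brh (brh a b) c + brh b (brh a c))
    (lam : k) (K : g →ₗ[k] g)
    (hK : ∀ x y : g, brg (K x) (K y) = K (brg (K x) y + brg x (K y)) + lam • brg x y)
    (Kh : gh →ₗ[k] gh)
    (hKh : ∀ a b : gh, brh (Kh a) (Kh b) = Kh (brh (Kh a) b + brh a (Kh b)) + lam • brh a b)
    (KV : V →ₗ[k] V)
    (i : V →ₗ[k] gh) (p : gh →ₗ[k] g)
    (hab : ∀ u v : V, brh (i u) (i v) = 0)
    (hphom : ∀ a b : gh, p (brh a b) = brg (p a) (p b))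
    (hiK : ∀ v : V, Kh (i v) = i (KV v))
    (hpK : ∀ a : gh, p (Kh a) = K (p a))
    (hinj : Function.Injective i) (hsurj : Function.Surjective p)
    (hker : LinearMap.ker p = LinearMap.range i)
    (s₁ s₂ : g →ₗ[k] gh) (hs₁ : ∀ x : g, p (s₁ x) = x) (hs₂ : ∀ x : g, p (s₂ x) = x)
    (ρL ρR : g → V → V)
    (hρL : ∀ (x : g) (v : V), i (ρL x v) = brh (s₁ x) (i v))
    (hρR : ∀ (x : g) (v : V), i (ρR x v) = brh (i v) (s₁ x))
    (ψ₁ ψ₂ : g → g → V)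
    (hψ₁ : ∀ x y : g, i (ψ₁ x y) = brh (s₁ x) (s₁ y) - s₁ (brg x y))
    (hψ₂ : ∀ x y : g, i (ψ₂ x y) = brh (s₂ x) (s₂ y) - s₂ (brg x y))
    (χ₁ χ₂ : g → V)
    (hχ₁ : ∀ x : g, i (χ₁ x) = Kh (s₁ x) - s₁ (K x))
    (hχ₂ : ∀ x : g, i (χ₂ x) = Kh (s₂ x) - s₂ (K x))
    (γ : g → V)
    (hγ : ∀ x : g, i (γ x) = s₁ x - s₂ x) :
    (∀ x y : g,
      ψ₁ x y = ψ₂ x y + ρL x (γ y) + ρR y (γ x) - γ (brg x y)) ∧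
    (∀ x : g, χ₁ x = χ₂ x + KV (γ x) - γ (K x)) := by
  refine ⟨fun x y => hinj ?_, fun x => hinj ?_⟩
  · have h := hab (γ x) (γ y)
    simp only [hγ, map_sub, LinearMap.sub_apply] at h
    simp only [map_add, map_sub, hψ₁, hψ₂, hρL, hρR, hγ, LinearMap.sub_apply]
    rw [← sub_eq_zero, ← neg_eq_zero, ← h]
    abel
  · simp only [map_add, map_sub, hχ₁, hχ₂, ← hiK, hγ]
    abel
end

section
/- Let (g,[·,·],K) be a modified Rota-Baxter Leibniz algebra of weight λ over a field k of characteristic 0, let (V,ρL,ρR,K_V) be a representation of it, and let (ψ₁,χ₁) and (ψ₂,χ₂) be two 2-cocycles (each satisfying conditions (a) and (b) below). Suppose there is a linear map γ : g → V with ψ₁(x,y) = ψ₂(x,y) + ρL(x)γ(y) + ρR(y)γ(x) − γ([x,y]) and χ₁(x) = χ₂(x) + K_V(γ(x)) − γ(K x) for all x,y ∈ g. Then the linear map ζ : g ⊕ V → g ⊕ V, ζ(x,u) := (x, γ(x) + u), is an isomorphism of modified Rota-Baxter Leibniz algebras from (g ⊕ V, [·,·]_{ψ₁}, K_{χ₁})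 to (g ⊕ V, [·,·]_{ψ₂}, K_{χ₂}): ζ is bijective, ζ([(x,u),(y,v)]_{ψ₁}) = [ζ(x,u), ζ(y,v)]_{ψ₂}, and ζ ∘ K_{χ₁} = K_{χ₂} ∘ ζ. -/
/-- Two cohomologous 2-cocycles `(ψ₁, χ₁)` and `(ψ₂, χ₂)` of a modified Rota-Baxter
Leibniz algebra `(g, br, K)` with coefficients in `(V, ρL, ρR, KV)` give rise to
isomorphic abelian extensions: `ζ (x, u) = (x, γ x + u)` is an isomorphism of the
corresponding modified Rota-Baxter Leibniz algebra structures on `g ⊕ V`. -/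
theorem statement16 {k : Type*} [Field k] [CharZero k]
    {g : Type*} [AddCommGroup g] [Module k g]
    {V : Type*} [AddCommGroup V] [Module k V]
    (br : g →ₗ[k] g →ₗ[k] g)
    (hLeib : ∀ x y z : g, br x (br y z) = br (br x y) z + br y (br x z))
    (lam : k) (K : g →ₗ[k] g)
    (hK : ∀ x y : g, br (K x) (K y) = K (br (K x) y + br x (K y)) + lam • br x y)
    (ρL ρR : g →ₗ[k] Module.End k V)
    (hL : ∀ (x y : g) (v : V), ρL (br x y) v = ρL x (ρL y v) - ρL y (ρL x v))
    (hR1 : ∀ (x y : g) (v : V), ρR (br x y) v = ρL x (ρR y v) - ρR y (ρL x v))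
    (hR2 : ∀ (x y : g) (v : V), ρR (br x y) v = ρL x (ρR y v) + ρR y (ρR x v))
    (KV : V →ₗ[k] V)
    (hKVL : ∀ (x : g) (v : V),
      ρL (K x) (KV v) = KV (ρL (K x) v + ρL x (KV v)) + lam • ρL x v)
    (hKVR : ∀ (x : g) (v : V),
      ρR (K x) (KV v) = KV (ρR (K x) v + ρR x (KV v)) + lam • ρR x v)
    (ψ₁ ψ₂ : g →ₗ[k] g →ₗ[k] V) (χ₁ χ₂ : g →ₗ[k] V)
    (hcoc₁a : ∀ x y z : g,
      ψ₁ x (br y z) + ρL x (ψ₁ y z) =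
        ρL y (ψ₁ x z) + ρR z (ψ₁ x y) + ψ₁ (br x y) z + ψ₁ y (br x z))
    (hcoc₁b : ∀ x y : g,
      ψ₁ (K x) (K y) + ρL (K x) (χ₁ y) + ρR (K y) (χ₁ x) =
        χ₁ (br (K x) y + br x (K y))
          + KV (ψ₁ (K x) y + ψ₁ x (K y) + ρL x (χ₁ y) + ρR y (χ₁ x))
          + lam • ψ₁ x y)
    (hcoc₂a : ∀ x y z : g,
      ψ₂ x (br y z) + ρL x (ψ₂ y z) =
        ρL y (ψ₂ x z) + ρR z (ψ₂ x y) + ψ₂ (br x y) z + ψ₂ y (br x z))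
    (hcoc₂b : ∀ x y : g,
      ψ₂ (K x) (K y) + ρL (K x) (χ₂ y) + ρR (K y) (χ₂ x) =
        χ₂ (br (K x) y + br x (K y))
          + KV (ψ₂ (K x) y + ψ₂ x (K y) + ρL x (χ₂ y) + ρR y (χ₂ x))
          + lam • ψ₂ x y)
    (γ : g →ₗ[k] V)
    (hγψ : ∀ x y : g,
      ψ₁ x y = ψ₂ x y + ρL x (γ y) + ρR y (γ x) - γ (br x y))
    (hγχ : ∀ x : g, χ₁ x = χ₂ x + KV (γ x) - γ (K x))
    (brP₁ brP₂ : g × V → g × V → g × V)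
    (hbrP₁ : ∀ a b : g × V,
      brP₁ a b = (br a.1 b.1, ρL a.1 b.2 + ρR b.1 a.2 + ψ₁ a.1 b.1))
    (hbrP₂ : ∀ a b : g × V,
      brP₂ a b = (br a.1 b.1, ρL a.1 b.2 + ρR b.1 a.2 + ψ₂ a.1 b.1))
    (KP₁ KP₂ : g × V → g × V)
    (hKP₁ : ∀ a : g × V, KP₁ a = (K a.1, χ₁ a.1 + KV a.2))
    (hKP₂ : ∀ a : g × V, KP₂ a = (K a.1, χ₂ a.1 + KV a.2))
    (ζ : g × V → g × V)
    (hζ : ∀ a : g × V, ζ a = (a.1, γ a.1 + a.2)) :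
    Function.Bijective ζ ∧
    (∀ a b : g × V, ζ (brP₁ a b) = brP₂ (ζ a) (ζ b)) ∧
    (∀ a : g × V, ζ (KP₁ a) = KP₂ (ζ a)) := by
  refine ⟨⟨fun a b hab => ?_, fun b => ⟨(b.1, b.2 - γ b.1), by simp [hζ]⟩⟩,
    fun a b => ?_, fun a => ?_⟩
  · rw [hζ, hζ, Prod.mk.injEq] at hab
    obtain ⟨h₁, h₂⟩ := hab
    rw [h₁] at h₂
    exact Prod.ext h₁ (add_left_cancel h₂)
  · simp only [hζ, hbrP₁, hbrP₂, hγψ, map_add]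
    congr 1
    abel
  · simp only [hζ, hKP₁, hKP₂, hγχ, map_add]
    congr 1
    abel
end
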